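/- Let λ > 0, and for n ≥ 2 let b_n be the unique real number with F_λ(b_n) = 1 - 1/n. Define h_n(x) = n log F_λ(b_n + x/b_n) + e^{-x}, κ(x) = 2^{-1}(x² + 2x) e^{-x}, and ω(x) = -8^{-1}(x⁴ + 4x³ + 8x² + 16x) e^{-x}. Then for every real x, b_n² ( b_n² h_n(x) - κ(x) ) → ω(x) as n → ∞. -/

import Mathlib

open Real MeasureTheory Filter Topology

/-- Standard normal density. -/
noncomputable def stdPhi (x : ℝ) : ℝ := (Real.sqrt (2 * Real.pi))⁻¹ * Real.exp (-(x ^ 2) / 2)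

/-- Standard normal cdf. -/
noncomputable def stdCdf (x : ℝ) : ℝ := ∫ t in Set.Iic x, stdPhi t

/-- Skew normal density with shape parameter l. -/
noncomputable def snPdf (l x : ℝ) : ℝ := 2 * stdPhi x * stdCdf (l * x)

/-- Skew normal cdf with shape parameter l. -/
noncomputable def snCdf (l x : ℝ) : ℝ := ∫ t in Set.Iic x, snPdf l t

/-- Gumbel extreme value distribution function. -/
noncomputable def gumbel (x : ℝ) : ℝ := Real.exp (-Real.exp (-x))

/-- $\kappa(x)$ for $\lambda>0$. -/
noncomputable def kappaPos (x : ℝ) : ℝ := 2⁻¹ * (x ^ 2 + 2 * x) * Real.exp (-x)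

/-- $\omega(x)$ for $\lambda>0$. -/
noncomputable def omegaPos (x : ℝ) : ℝ :=
  -(8⁻¹ * (x ^ 4 + 4 * x ^ 3 + 8 * x ^ 2 + 16 * x) * Real.exp (-x))


lemma stdPhi_pos (x : ℝ) : 0 < stdPhi x := by
  unfold stdPhi; positivity

lemma stdPhi_cont : Continuous stdPhi := by
  unfold stdPhi; fun_prop

lemma stdPhi_eq : stdPhi = fun x => (Real.sqrt (2 * Real.pi))⁻¹ * Real.exp (-(1/2) * x ^ 2) := by
  funext x; unfold stdPhi; congr 2; ring

lemma stdPhi_int : Integrable stdPhi := by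
  rw [stdPhi_eq]
  exact (integrable_exp_neg_mul_sq (by norm_num)).const_mul _

lemma stdPhi_total : ∫ x, stdPhi x = 1 := by
  rw [stdPhi_eq, integral_const_mul, integral_gaussian]
  rw [show π / (1/2) = 2 * π by ring]
  exact inv_mul_cancel₀ (by positivity)

lemma stdPhi_neg (x : ℝ) : stdPhi (-x) = stdPhi x := by
  unfold stdPhi; simp

lemma stdPhi_deriv (x : ℝ) : HasDerivAt stdPhi (-x * stdPhi x) x := by
  unfold stdPhi
  have h : HasDerivAt (fun x : ℝ => -(x^2)/2) (-x) x := by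
    exact (((hasDerivAt_pow 2 x).neg).div_const 2).congr_deriv (by norm_num; ring)
  exact ((h.exp).const_mul (Real.sqrt (2 * Real.pi))⁻¹).congr_deriv (by ring)

lemma stdPhi_decay (k : ℕ) : Tendsto (fun x => x ^ k * stdPhi x) atTop (𝓝 0) := by
  have h := (rpow_mul_exp_neg_mul_sq_isLittleO_exp_neg (b := 1/2) (by norm_num) k).tendsto_zero_of_tendsto
      (tendsto_exp_atBot.comp <| tendsto_id.const_mul_atTop_of_neg (neg_lt_zero.mpr one_half_pos))
  have h2 := h.const_mul (Real.sqrt (2 * Real.pi))⁻¹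
  rw [mul_zero] at h2
  refine h2.congr fun x => ?_
  rw [stdPhi_eq, Real.rpow_natCast]; ring

lemma cdf_deriv {f : ℝ → ℝ} (hf : Continuous f) (hi : Integrable f) (x : ℝ) :
    HasDerivAt (fun y => ∫ t in Set.Iic y, f t) (f x) x := by
  have h : (fun y => ∫ t in Set.Iic y, f t) =
      fun y => (∫ t in Set.Iic 0, f t) + ∫ t in (0:ℝ)..y, f t := by
    funext y
    rw [← intervalIntegral.integral_Iic_sub_Iic hi.integrableOn hi.integrableOn]
    ring
  rw [h]
  exact ((intervalIntegral.integral_hasDerivAt_right (hf.intervalIntegrable _ _)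
    hf.aestronglyMeasurable.stronglyMeasurableAtFilter hf.continuousAt)).const_add _

lemma cdf_lim {f : ℝ → ℝ} (hi : Integrable f) :
    Tendsto (fun y => ∫ t in Set.Iic y, f t) atTop (𝓝 (∫ t, f t)) :=
  (aecover_Iic tendsto_id).integral_tendsto_of_countably_generated hi

lemma stdCdf_deriv (x : ℝ) : HasDerivAt stdCdf (stdPhi x) x := cdf_deriv stdPhi_cont stdPhi_int x

lemma stdCdf_cont : Continuous stdCdf :=
  continuous_iff_continuousAt.2 fun x => (stdCdf_deriv x).continuousAt

lemma stdCdf_lim : Tendsto stdCdf atTop (𝓝 1) := by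
  have := cdf_lim stdPhi_int
  rwa [stdPhi_total] at this

lemma stdCdf_neg (x : ℝ) : stdCdf x + stdCdf (-x) = 1 := by
  have h : stdCdf (-x) = ∫ t in Set.Ioi x, stdPhi t := by
    unfold stdCdf
    rw [← integral_comp_neg_Ioi]
    simp [stdPhi_neg]
  rw [h, stdCdf, intervalIntegral.integral_Iic_add_Ioi stdPhi_int.integrableOn stdPhi_int.integrableOn, stdPhi_total]

lemma stdCdf_mono : StrictMono stdCdf := strictMono_of_hasDerivAt_pos stdCdf_deriv stdPhi_pos

lemma stdCdf_nonneg (x : ℝ) : 0 ≤ stdCdf x :=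
  setIntegral_nonneg measurableSet_Iic fun t _ => (stdPhi_pos t).le

lemma stdCdf_pos (x : ℝ) : 0 < stdCdf x :=
  (stdCdf_nonneg (x-1)).trans_lt (stdCdf_mono (by linarith))

lemma stdCdf_le_one (x : ℝ) : stdCdf x ≤ 1 := by
  have := stdCdf_neg x
  have := stdCdf_nonneg (-x)
  linarith

lemma snPdf_pos (l x : ℝ) : 0 < snPdf l x := by
  have := stdPhi_pos x
  have := stdCdf_pos (l*x)
  unfold snPdf; positivity

lemma snPdf_cont (l : ℝ) : Continuous (snPdf l) := by
  have := stdPhi_cont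
  have := stdCdf_cont
  unfold snPdf; fun_prop

lemma snPdf_le (l x : ℝ) : snPdf l x ≤ 2 * stdPhi x := by
  unfold snPdf
  have := stdPhi_pos x
  exact mul_le_of_le_one_right (by positivity) (stdCdf_le_one _)

lemma snPdf_int (l : ℝ) : Integrable (snPdf l) := by
  refine (stdPhi_int.const_mul 2).mono' (snPdf_cont l).aestronglyMeasurable ?_
  refine Eventually.of_forall fun x => ?_
  rw [Real.norm_of_nonneg (snPdf_pos l x).le]
  exact snPdf_le l x

lemma snPdf_total (l : ℝ) : ∫ x, snPdf l x = 1 := by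
  have h1 : ∫ x, snPdf l (-x) = ∫ x, snPdf l x := integral_neg_eq_self _ _
  have h2 : ∫ x, (snPdf l x + snPdf l (-x)) = 2 := by
    have : (fun x => snPdf l x + snPdf l (-x)) = fun x => 2 * stdPhi x := by
      funext x
      have := stdCdf_neg (l*x)
      unfold snPdf
      rw [stdPhi_neg, mul_neg]
      linear_combination 2 * stdPhi x * this
    rw [this, integral_const_mul, stdPhi_total]; norm_num
  rw [integral_add (snPdf_int l) (snPdf_int l).comp_neg, h1] at h2
  linarith

lemma snCdf_deriv (l x : ℝ) : HasDerivAt (snCdf l) (snPdf l x) x :=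
  cdf_deriv (snPdf_cont l) (snPdf_int l) x

lemma snCdf_lim (l : ℝ) : Tendsto (snCdf l) atTop (𝓝 1) := by
  have := cdf_lim (snPdf_int l)
  rwa [snPdf_total] at this

lemma snCdf_mono (l : ℝ) : StrictMono (snCdf l) :=
  strictMono_of_hasDerivAt_pos (snCdf_deriv l) (snPdf_pos l)

lemma snCdf_lt_one (l x : ℝ) : snCdf l x < 1 :=
  (snCdf_mono l (by linarith : x < x + 1)).trans_le
    ((snCdf_mono l).monotone.ge_of_tendsto (snCdf_lim l) _)

/-- tail decay -/
lemma tail_decay {F f : ℝ → ℝ} (hF : ∀ x, HasDerivAt F (f x) x) (hl : Tendsto F atTop (𝓝 1))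
    (hf : Tendsto (fun x => x ^ 5 * f x) atTop (𝓝 0)) :
    Tendsto (fun x => x ^ 4 * (1 - F x)) atTop (𝓝 0) := by
  have h := HasDerivAt.lhopital_zero_atTop (f := fun x => 1 - F x) (g := fun x => (x ^ 4)⁻¹)
    (f' := fun x => - f x) (g' := fun x => -(4 * x ^ 3) / (x ^ 4) ^ 2) (l := 𝓝 0)
    (Eventually.of_forall fun x => by simpa using (hF x).const_sub 1)
    ((eventually_gt_atTop 0).mono fun x hx => by
      exact ((hasDerivAt_pow 4 x).fun_inv (by positivity)).congr_deriv (by norm_num))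
    ((eventually_gt_atTop 0).mono fun x hx => by
      have : 0 < (4 * x ^ 3) / (x ^ 4) ^ 2 := by positivity
      rw [neg_div]; exact (neg_neg_of_pos this).ne)
    (by simpa using hl.const_sub 1)
    (tendsto_inv_atTop_zero.comp (tendsto_pow_atTop (by norm_num)))
    (by
      have h2 := hf.const_mul (1/4)
      rw [mul_zero] at h2
      refine h2.congr' ((eventually_gt_atTop 0).mono fun x hx => ?_)
      field_simp)
  refine h.congr fun x => ?_
  rw [div_inv_eq_mul, mul_comm]

lemma std_tail_scaled {l : ℝ} (hl : 0 < l) :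
    Tendsto (fun x => x ^ 4 * (1 - stdCdf (l * x))) atTop (𝓝 0) := by
  have h := tail_decay stdCdf_deriv stdCdf_lim (stdPhi_decay 5)
  have h2 := (h.comp (tendsto_id.const_mul_atTop hl)).const_mul ((l ^ 4)⁻¹)
  rw [mul_zero] at h2
  refine h2.congr fun x => ?_
  simp only [Function.comp, id]
  field_simp

lemma sn_tail (l : ℝ) : Tendsto (fun x => x ^ 4 * (1 - snCdf l x)) atTop (𝓝 0) := by
  refine tail_decay (snCdf_deriv l) (snCdf_lim l) ?_
  have h := (stdPhi_decay 5).const_mul 2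
  rw [mul_zero] at h
  refine squeeze_zero' ((eventually_gt_atTop 0).mono fun x hx => ?_)
    ((eventually_gt_atTop 0).mono fun x hx => ?_) h
  · have := snPdf_pos l x
    positivity
  · have := snPdf_le l x
    calc x ^ 5 * snPdf l x ≤ x ^ 5 * (2 * stdPhi x) := by gcongr
      _ = _ := by ring

lemma inv_pow_deriv (k : ℕ) {x : ℝ} (hx : 0 < x) :
    HasDerivAt (fun x : ℝ => (x ^ (k+1))⁻¹) (-(k+1) * (x ^ (k+2))⁻¹) x := by
  refine ((hasDerivAt_pow (k+1) x).fun_inv (by positivity)).congr_deriv ?_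
  push_cast
  field_simp
  ring

lemma inv_pow_lim (k : ℕ) : Tendsto (fun x : ℝ => (x ^ (k+1))⁻¹) atTop (𝓝 0) :=
  tendsto_inv_atTop_zero.comp (tendsto_pow_atTop (by simp))

lemma mills {l : ℝ} (hl : 0 < l) :
    Tendsto (fun t => ((1 - snCdf l t) -
      2 * (stdPhi t * ((t ^ 1)⁻¹ - (t ^ 3)⁻¹ + 3 * (t ^ 5)⁻¹))) /
        (2 * (stdPhi t * (t ^ 5)⁻¹))) atTop (𝓝 0) := by
  have hphi : Tendsto stdPhi atTop (𝓝 0) := by simpa using stdPhi_decay 0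
  have i1 := inv_pow_lim 0
  have i3 := inv_pow_lim 2
  have i5 := inv_pow_lim 4
  have i2 := inv_pow_lim 1
  norm_num at i1 i2 i3 i5
  have hF := (snCdf_lim l).const_sub 1
  refine HasDerivAt.lhopital_zero_atTop
    (f' := fun t => 2 * stdPhi t * ((1 - stdCdf (l * t)) + 15 * (t ^ 6)⁻¹))
    (g' := fun t => - (2 * stdPhi t * (5 * (t ^ 6)⁻¹ + (t ^ 4)⁻¹)))
    ((eventually_gt_atTop 0).mono fun t ht => ?_)
    ((eventually_gt_atTop 0).mono fun t ht => ?_)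
    ((eventually_gt_atTop 0).mono fun t ht => ?_) ?_ ?_ ?_
  · have hp := ((inv_pow_deriv 0 ht).fun_sub (inv_pow_deriv 2 ht)).fun_add
      ((inv_pow_deriv 4 ht).const_mul 3)
    refine (((snCdf_deriv l t).const_sub 1).fun_sub
      (((stdPhi_deriv t).fun_mul hp).const_mul 2)).congr_deriv ?_
    unfold snPdf
    push_cast
    field_simp
    ring
  · refine (((stdPhi_deriv t).fun_mul (inv_pow_deriv 4 ht)).const_mul 2).congr_deriv ?_
    push_cast
    field_simp
    ring
  · have := stdPhi_pos t
    have : 0 < 2 * stdPhi t * (5 * (t ^ 6)⁻¹ + (t ^ 4)⁻¹) := by positivity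
    exact (neg_neg_of_pos this).ne
  · have := hF.sub ((hphi.mul ((i1.sub i3).add (i5.const_mul 3))).const_mul 2)
    simpa using this
  · simpa using (hphi.mul i5).const_mul 2
  · have h := (((std_tail_scaled hl).add (i2.const_mul 15)).div
      ((i2.const_mul 5).add_const 1) (by norm_num)).neg
    norm_num at h
    refine h.congr' ((eventually_gt_atTop 0).mono fun t ht => ?_)
    have := (stdPhi_pos t).ne'
    beta_reduce
    rw [div_neg, neg_inj, mul_div_mul_left _ _ (by positivity), div_eq_div_iff (by positivity) (by positivity)]
    field_simp

/-- normalised Mills ratio -/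
noncomputable def qq (l t : ℝ) : ℝ := (1 - snCdf l t) * t / (2 * stdPhi t)

lemma qq_lim {l : ℝ} (hl : 0 < l) :
    Tendsto (fun t => (qq l t - 1 + (t ^ 2)⁻¹) * t ^ 4) atTop (𝓝 3) := by
  have h := (mills hl).add_const 3
  rw [zero_add] at h
  refine h.congr' ((eventually_gt_atTop 0).mono fun t ht => ?_)
  have := (stdPhi_pos t).ne'
  unfold qq
  field_simp
  ring

def E2 (u f : ℕ → ℝ) (a b : ℝ) : Prop :=
  Tendsto (fun n => (f n - 1 - a * u n) / (u n) ^ 2) atTop (𝓝 b)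

lemma E2.lim {u f : ℕ → ℝ} {a b : ℝ} (hf : E2 u f a b) (hu : Tendsto u atTop (𝓝 0))
    (h0 : ∀ᶠ n in atTop, u n ≠ 0) : Tendsto f atTop (𝓝 1) := by
  have h := ((Tendsto.mul hf (hu.pow 2)).add (hu.const_mul a)).add_const 1
  norm_num at h
  refine h.congr' (h0.mono fun n hn => ?_)
  field_simp
  ring

lemma E2.mul {u f g : ℕ → ℝ} {a b a' b' : ℝ} (hf : E2 u f a b) (hg : E2 u g a' b')
    (hu : Tendsto u atTop (𝓝 0)) (h0 : ∀ᶠ n in atTop, u n ≠ 0) :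
    E2 u (fun n => f n * g n) (a + a') (a * a' + b + b') := by
  have h := ((hf.const_add (a * a')).add hg).add ((hu.mul ((hg.const_mul a).add (hf.const_mul a'))).add
    ((hu.pow 2).mul (Tendsto.mul hf hg)))
  norm_num at h
  refine h.congr' (h0.mono fun n hn => ?_)
  field_simp
  ring

lemma E2.inv {u f : ℕ → ℝ} {a b : ℝ} (hf : E2 u f a b)
    (hu : Tendsto u atTop (𝓝 0)) (h0 : ∀ᶠ n in atTop, u n ≠ 0) :
    E2 u (fun n => (f n)⁻¹) (-a) (a ^ 2 - b) := by
  have hl := hf.lim hu h0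
  have h := ((hf.const_sub (a ^ 2)).add ((Tendsto.mul hf hu).const_mul a)).div hl one_ne_zero
  norm_num at h
  have h1 : ∀ᶠ n in atTop, f n ≠ 0 := hl.eventually_ne one_ne_zero
  refine h.congr' ((h0.and h1).mono fun n ⟨hn, hn1⟩ => ?_)
  simp only [Pi.div_apply]
  field_simp
  ring

lemma E2_exp {u : ℕ → ℝ} (c : ℝ) (hu : Tendsto u atTop (𝓝 0))
    (h0 : ∀ᶠ n in atTop, u n ≠ 0) :
    E2 u (fun n => Real.exp (c * u n)) c (c ^ 2 / 2) := by
  have hc : Tendsto (fun n => c * u n) atTop (𝓝 0) := by simpa using hu.const_mul c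
  have h := (Real.exp_sub_sum_range_succ_isLittleO_pow 2).comp_tendsto hc
  have hO : ((fun y : ℝ => y ^ 2) ∘ fun n => c * u n) =O[atTop] fun n => u n ^ 2 := by
    refine Asymptotics.IsBigO.of_bound (c ^ 2) (Eventually.of_forall fun n => ?_)
    simp [mul_pow]
  have h2 := ((h.trans_isBigO hO).tendsto_div_nhds_zero).add_const (c ^ 2 / 2)
  rw [zero_add] at h2
  refine h2.congr' (h0.mono fun n hn => ?_)
  simp [Finset.sum_range_succ]
  field_simp
  ring

lemma E2_lin {u : ℕ → ℝ} (x : ℝ) : E2 u (fun n => 1 + x * u n) x 0 := by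
  unfold E2
  simp

lemma b_atTop {l : ℝ} {b : ℕ → ℝ} (hb : ∀ n : ℕ, 2 ≤ n → snCdf l (b n) = 1 - 1 / n) :
    Tendsto b atTop atTop := by
  rw [tendsto_atTop]
  intro M
  have h : Tendsto (fun n : ℕ => (1 : ℝ) - 1 / n) atTop (𝓝 1) := by
    simpa using (tendsto_one_div_atTop_nhds_zero_nat (𝕜 := ℝ)).const_sub 1
  filter_upwards [h.eventually (lt_mem_nhds (snCdf_lt_one l M)), eventually_ge_atTop 2] with n h1 h2
  rw [← hb n h2] at h1
  exact ((snCdf_mono l).lt_iff_lt.1 h1).le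

lemma qq_b {l : ℝ} (hl : 0 < l) {b : ℕ → ℝ} (hbt : Tendsto b atTop atTop) :
    E2 (fun n => (b n ^ 2)⁻¹) (fun n => qq l (b n)) (-1) 3 := by
  refine ((qq_lim hl).comp hbt).congr' ((hbt.eventually_gt_atTop 0).mono fun n hn => ?_)
  simp only [Function.comp]
  field_simp
  ring

lemma qq_t {l : ℝ} (hl : 0 < l) {b : ℕ → ℝ} (hbt : Tendsto b atTop atTop) (x : ℝ)
    (hu : Tendsto (fun n => (b n ^ 2)⁻¹) atTop (𝓝 0))
    (htt : Tendsto (fun n => b n + x / b n) atTop atTop) :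
    E2 (fun n => (b n ^ 2)⁻¹) (fun n => qq l (b n + x / b n)) (-1) (3 + 2 * x) := by
  have hs : Tendsto (fun n => 1 + x * (b n ^ 2)⁻¹) atTop (𝓝 1) := by
    simpa using (hu.const_mul x).const_add 1
  have h := ((((qq_lim hl).comp htt).mul ((hs.pow 4).inv₀ (by norm_num)))).add
    (((hu.const_mul (x ^ 2)).const_add (2 * x)).div (hs.pow 2) (by norm_num))
  norm_num at h
  refine h.congr' (((hbt.eventually_gt_atTop 0).and (htt.eventually_gt_atTop 0)).mono fun n hn => ?_)
  obtain ⟨hn, hn2⟩ := hn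
  simp only [Function.comp]
  have e : 1 + x * (b n ^ 2)⁻¹ = (b n + x / b n) / b n := by field_simp
  have ex : x = (b n + x / b n) * b n - b n ^ 2 := by field_simp; ring
  rw [e]
  generalize b n + x / b n = t at *
  generalize qq l t = q
  subst ex
  field_simp
  ring

lemma log_part {F : ℕ → ℝ} {B : ℕ → ℝ} {c : ℝ}
    (hy : Tendsto (fun n : ℕ => (n : ℝ) * (1 - F n)) atTop (𝓝 c))
    (hF : Tendsto F atTop (𝓝 1))
    (hB : Tendsto (fun n : ℕ => B n ^ 4 / n) atTop (𝓝 0)) :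
    Tendsto (fun n : ℕ => B n ^ 4 * (n * Real.log (F n) + n * (1 - F n))) atTop (𝓝 0) := by
  have h := ((hy.pow 2).mul hB).const_mul 2
  rw [mul_zero, mul_zero] at h
  refine squeeze_zero_norm' ?_ h
  filter_upwards [hF.eventually (lt_mem_nhds (show (1/2 : ℝ) < 1 by norm_num)),
    hF.eventually (gt_mem_nhds (show (1 : ℝ) < 3/2 by norm_num)),
    eventually_gt_atTop 0] with n h1 h2 hn
  have ha : |1 - F n| ≤ 1/2 := by rw [abs_le]; constructor <;> linarith
  have hlog := Real.abs_log_sub_add_sum_range_le (x := 1 - F n) (by linarith) 1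
  have hn' : (0:ℝ) < n := by exact_mod_cast hn
  simp only [Finset.sum_range_one, sub_sub_cancel, sq_abs, Nat.reduceAdd, Nat.cast_zero, zero_add,
    pow_one, div_one] at hlog
  have h3 : (1 - F n) ^ 2 / (1 - |1 - F n|) ≤ 2 * (1 - F n) ^ 2 := by
    rw [div_le_iff₀ (by linarith)]
    nlinarith [sq_nonneg (1 - F n)]
  rw [← mul_add, norm_mul, norm_mul, Real.norm_eq_abs, Real.norm_eq_abs, Real.norm_eq_abs,
    abs_of_pos hn', abs_of_nonneg (by positivity : 0 ≤ B n ^ 4), add_comm (Real.log _)]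
  calc B n ^ 4 * (n * |1 - F n + Real.log (F n)|)
      ≤ B n ^ 4 * (n * (2 * (1 - F n) ^ 2)) := by gcongr; exact hlog.trans h3
    _ = _ := by field_simp

theorem skew_normal_h_second_order_pos (l : ℝ) (hl : 0 < l) (b : ℕ → ℝ)
    (hb : ∀ n : ℕ, 2 ≤ n → snCdf l (b n) = 1 - 1 / n) (x : ℝ) :
    Tendsto (fun n : ℕ =>
      (b n) ^ 2 * ((b n) ^ 2 *
        ((n : ℝ) * Real.log (snCdf l (b n + x / b n)) + Real.exp (-x)) - kappaPos x))
      atTop (𝓝 (omegaPos x)) := by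
  have hbt := b_atTop hb
  have hpos := hbt.eventually_gt_atTop 0
  have hu : Tendsto (fun n => (b n ^ 2)⁻¹) atTop (𝓝 0) := (inv_pow_lim 1).comp hbt
  have h0 : ∀ᶠ n in atTop, (b n ^ 2)⁻¹ ≠ 0 := hpos.mono fun n hn => by positivity
  have htt : Tendsto (fun n => b n + x / b n) atTop atTop :=
    hbt.atTop_add (hbt.const_div_atTop x)
  have hP := ((E2_exp (-(x ^ 2 / 2)) hu h0).mul ((E2_lin x).inv hu h0) hu h0).mul
    ((qq_t hl hbt x hu htt).mul ((qq_b hl hbt).inv hu h0) hu h0) hu h0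
  have hPl := hP.lim hu h0
  set P : ℕ → ℝ := fun n => Real.exp (-(x ^ 2 / 2) * (b n ^ 2)⁻¹) * (1 + x * (b n ^ 2)⁻¹)⁻¹ *
    (qq l (b n + x / b n) * (qq l (b n))⁻¹) with hPdef
  have key : ∀ᶠ n : ℕ in atTop, Real.exp (-x) * P n = n * (1 - snCdf l (b n + x / b n)) := by
    filter_upwards [hpos, htt.eventually_gt_atTop 0, eventually_ge_atTop 2] with n hn ht h2
    have hn' : (n : ℝ) ≠ 0 := by positivity
    have e : 1 + x * (b n ^ 2)⁻¹ = (b n + x / b n) / b n := by field_simp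
    have ephi : stdPhi (b n + x / b n) =
        stdPhi (b n) * (Real.exp (-x) * Real.exp (-(x ^ 2 / 2) * (b n ^ 2)⁻¹)) := by
      unfold stdPhi
      rw [mul_assoc, ← Real.exp_add, ← Real.exp_add]
      congr 2
      field_simp
      ring
    have p1 := (stdPhi_pos (b n)).ne'
    simp only [hPdef]
    rw [e]
    unfold qq
    rw [ephi, hb n h2]
    have q1 := (Real.exp_pos (-x)).ne'
    have q2 := (Real.exp_pos (-(x ^ 2 / 2) * (b n ^ 2)⁻¹)).ne'
    generalize b n + x / b n = t at *
    generalize Real.exp (-(x ^ 2 / 2) * (b n ^ 2)⁻¹) = r at *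
    generalize Real.exp (-x) = s at *
    field_simp
    ring
  have hy : Tendsto (fun n : ℕ => (n : ℝ) * (1 - snCdf l (b n + x / b n))) atTop
      (𝓝 (Real.exp (-x))) := by
    have := hPl.const_mul (Real.exp (-x))
    rw [mul_one] at this
    exact this.congr' key
  have hB : Tendsto (fun n : ℕ => b n ^ 4 / n) atTop (𝓝 0) := by
    refine ((sn_tail l).comp hbt).congr' ((eventually_ge_atTop 2).mono fun n h2 => ?_)
    simp only [Function.comp]
    rw [hb n h2]
    ring
  have hL := log_part hy ((snCdf_lim l).comp htt) hB
  have hfin := hL.add (Tendsto.const_mul (-Real.exp (-x)) hP)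
  have hlim : omegaPos x = 0 + -Real.exp (-x) * (( -(x ^ 2 / 2) + -x) * (-1 + - -1) + (-(x ^ 2 / 2) * -x
      + (-(x^2/2))^2/2 + (x^2 - 0)) + (-1 * - -1 + (3 + 2 * x) + ((-1)^2 - 3))) := by
    unfold omegaPos; ring
  rw [hlim]
  refine hfin.congr' ?_
  filter_upwards [hpos, key] with n hn hk
  have hd : ∀ p q : ℝ, p / ((b n ^ 2)⁻¹) ^ 2 = p * b n ^ 4 := by intro p _; field_simp
  rw [← hk, hd _ 0]
  unfold kappaPos
  generalize P n = p
  field_simp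
  ring
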